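/- Let a, b be positive integers and c a positive rational number with c < a < b and a not dividing b. Let μ be a positive integer such that L(a,b,c) = ⌈μ·b/a⌉, and let R_μ be the unique positive integer satisfying (R_μ − 1)·a/(b mod a) < μ ≤ R_μ·a/(b mod a). Then μ = ⌈ R_μ·(a − c) / (c·⌊b/a⌋ + (b mod a)) ⌉. -/

import Mathlib

/-- The least positive solution of the proportionally modular Diophantine
inequality `(a*x mod b) ≤ c*x`. -/
noncomputable def L (a b : ℕ) (c : ℚ) : ℕ :=
  sInf {x : ℕ | 0 < x ∧ ((a * x % b : ℕ) : ℚ) ≤ c * x}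

theorem mul_lin_comb_mod {a b q r m R : ℕ} (hb : b = a * q + r) (hlow : m * r ≤ R * a)
    (hlt : R * a - m * r < b) : a * (m * q + R) % b = R * a - m * r := by
  have h : a * (m * q + R) = (R * a - m * r) + b * m := by
    zify [hlow]
    rw [hb]
    push_cast
    ring
  rw [h, Nat.add_mul_mod_self_left, Nat.mod_eq_of_lt hlt]

theorem L_mem {a b : ℕ} {c : ℚ} (hb : 0 < b) (hc : 0 < c) :
    0 < L a b c ∧ ((a * L a b c % b : ℕ) : ℚ) ≤ c * L a b c := by
  have hne : {x : ℕ | 0 < x ∧ ((a * x % b : ℕ) : ℚ) ≤ c * x}.Nonempty :=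
    ⟨b, hb, by rw [Nat.mul_mod_left]; push_cast; positivity⟩
  exact Nat.sInf_mem hne

theorem L_le {a b x : ℕ} {c : ℚ} (hx : 0 < x) (h : ((a * x % b : ℕ) : ℚ) ≤ c * x) :
    L a b c ≤ x :=
  Nat.sInf_le ⟨hx, h⟩

theorem stmt_10 (a b : ℕ) (c : ℚ) (ha : 0 < a) (hb : 0 < b) (hc : 0 < c)
    (hca : c < (a : ℚ)) (hab : a < b) (hndvd : ¬ a ∣ b)
    (μ R : ℕ) (hμ : 0 < μ) (hL : (L a b c : ℤ) = ⌈((μ : ℚ) * b) / a⌉)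
    (hR : 0 < R)
    (hR1 : ((R : ℚ) - 1) * a / (b % a : ℕ) < (μ : ℚ))
    (hR2 : (μ : ℚ) ≤ (R : ℚ) * a / (b % a : ℕ)) :
    (μ : ℤ) = ⌈(R : ℚ) * ((a : ℚ) - c) /
                (c * ((b / a : ℕ) : ℚ) + ((b % a : ℕ) : ℚ))⌉ := by
  have hdiv : b = a * (b / a) + b % a := (Nat.div_add_mod b a).symm
  have hr : 0 < b % a := Nat.pos_of_ne_zero fun h => hndvd (Nat.dvd_of_mod_eq_zero h)
  have hq : 0 < b / a := Nat.div_pos hab.le ha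
  generalize b / a = q at *
  generalize b % a = r at *
  have hrQ : (0 : ℚ) < r := by exact_mod_cast hr
  have haQ : (0 : ℚ) < a := by exact_mod_cast ha
  have hqQ : (0 : ℚ) < q := by exact_mod_cast hq
  have hRQ : (0 : ℚ) < R := by exact_mod_cast hR
  rw [div_lt_iff₀ hrQ] at hR1
  rw [le_div_iff₀ hrQ] at hR2
  have hlow : μ * r ≤ R * a := by exact_mod_cast hR2
  have hupp : R * a < μ * r + a := by
    have : (R : ℚ) * a < μ * r + a := by linarith
    exact_mod_cast this
  have hbQ : (b : ℚ) = a * q + r := by exact_mod_cast hdiv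
  have hLx : L a b c = μ * q + R := by
    have : ⌈((μ : ℚ) * b) / a⌉ = ((μ * q + R : ℕ) : ℤ) := by
      rw [Int.ceil_eq_iff, lt_div_iff₀ haQ, div_le_iff₀ haQ, hbQ]
      push_cast
      constructor <;> linarith
    exact_mod_cast hL.trans this
  have hden : 0 < c * q + r := by positivity
  symm
  rw [Int.ceil_eq_iff, lt_div_iff₀ hden, div_le_iff₀ hden]
  push_cast
  constructor
  · by_contra! hcon
    obtain ⟨m, rfl⟩ : ∃ m, μ = m + 1 := ⟨μ - 1, by omega⟩
    have hle : m * r ≤ R * a := by linarith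
    have haq : a ≤ a * q := Nat.le_mul_of_pos_right a hq
    have hlt : R * a - m * r < b := by
      have : (m + 1) * r = m * r + r := by ring
      omega
    have hmod := mul_lin_comb_mod hdiv hle hlt
    have hsol : ((a * (m * q + R) % b : ℕ) : ℚ) ≤ c * (m * q + R : ℕ) := by
      rw [hmod, Nat.cast_sub hle]
      push_cast at hcon ⊢
      linarith
    have := L_le (by omega) hsol
    rw [hLx, add_mul] at this
    omega
  · have hsol := (L_mem (a := a) hb hc).2
    rw [hLx, mul_lin_comb_mod hdiv hlow (by omega), Nat.cast_sub hlow] at hsol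
    push_cast at hsol
    linarith
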